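/- Let C' ⊆ ℝⁿ be a full-dimensional rational polyhedral cone with facets described by primitive integral exterior normals, let v ∉ C' be an integer vector, and let F₁, …, F_q be the facets of C' visible from v. Then C' + cone(v) = C' ∪ ⋃_{i=1}^q (F_i + cone(v)); that is, adjoining the ray through v to C' subdivides the new cone into C' together with the cones over the visible facets with apex ray v. -/

import Mathlib

def coneOf {n k : ℕ} (v : Fin k → (Fin n → ℝ)) : Set (Fin n → ℝ) :=
  {x | ∃ lam : Fin k → ℝ, (∀ i, 0 ≤ lam i) ∧ x = ∑ i, lam i • v i}

/-- `c` has coprime integer entries. -/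
def IsPrimitive {n : ℕ} (c : Fin n → ℤ) : Prop :=
  Finset.univ.gcd (fun t => (c t).natAbs) = 1

/-- `c` is the primitive integral exterior normal vector of a facet of the
full-dimensional cone `C`. -/
def IsFacetNormal {n : ℕ} (C : Set (Fin n → ℝ)) (c : Fin n → ℤ) : Prop :=
  IsPrimitive c ∧ (∀ y ∈ C, ∑ t, (c t : ℝ) * y t ≤ 0) ∧
    Module.finrank ℝ
      (Submodule.span ℝ {x | x ∈ C ∧ ∑ t, (c t : ℝ) * x t = 0}) = n - 1

/-- Minkowski sum `S + cone(w)`. -/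
def addRay {n : ℕ} (S : Set (Fin n → ℝ)) (w : Fin n → ℝ) : Set (Fin n → ℝ) :=
  {y | ∃ x ∈ S, ∃ μ : ℝ, 0 ≤ μ ∧ y = x + μ • w}

section Helpers
open scoped Matrix

lemma farkas_aux {n : ℕ} : ∀ (m : ℕ) (a : Fin m → Fin n → ℝ) (b : Fin n → ℝ),
    (∀ x : Fin n → ℝ, (∀ i, a i ⬝ᵥ x ≤ 0) → b ⬝ᵥ x ≤ 0) → b ∈ coneOf a := by
  intro m
  induction m with
  | zero =>
    intro a b h
    have h0 := h b (fun i => i.elim0)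
    have hb : b ⬝ᵥ b = 0 := le_antisymm h0 (by
      simp only [dotProduct]; exact Finset.sum_nonneg fun i _ => mul_self_nonneg _)
    refine ⟨fun i => i.elim0, fun i => i.elim0, ?_⟩
    simpa using dotProduct_self_eq_zero.mp hb
  | succ m ih =>
    intro a b h
    by_cases hc : ∀ x : Fin n → ℝ, (∀ i : Fin m, a i.succ ⬝ᵥ x ≤ 0) → b ⬝ᵥ x ≤ 0
    · obtain ⟨u, hu, hb⟩ := ih (fun i => a i.succ) b hc
      refine ⟨Fin.cons 0 u, ?_, ?_⟩
      · intro i; refine Fin.cases ?_ ?_ i <;> simp [hu]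
      · simp [Fin.sum_univ_succ, hb]
    · push Not at hc
      obtain ⟨x0, hx0, hbx0⟩ := hc
      have ha0 : 0 < a 0 ⬝ᵥ x0 := by
        by_contra hcon
        push Not at hcon
        have := h x0 (fun i => by refine Fin.cases hcon hx0 i)
        linarith
      set s := (a 0 ⬝ᵥ x0)⁻¹ with hs
      have hspos : 0 < s := inv_pos.mpr ha0
      have hs1 : s * (a 0 ⬝ᵥ x0) = 1 := inv_mul_cancel₀ ha0.ne'
      obtain ⟨u, hu, hb⟩ := ih (fun i => a i.succ - (s * (a i.succ ⬝ᵥ x0)) • a 0)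
        (b - (s * (b ⬝ᵥ x0)) • a 0) (by
          intro x hx
          have := h (x - (s * (a 0 ⬝ᵥ x)) • x0) (by
            intro i
            refine Fin.cases ?_ ?_ i
            · simp only [dotProduct_sub, dotProduct_smul, smul_eq_mul]
              have : s * (a 0 ⬝ᵥ x) * (a 0 ⬝ᵥ x0) = a 0 ⬝ᵥ x := by
                rw [mul_right_comm, hs1, one_mul]
              linarith
            · intro j
              have := hx j
              simp only [dotProduct_sub, dotProduct_smul, sub_dotProduct, smul_dotProduct,
                smul_eq_mul] at this ⊢
              linarith)
          simp only [dotProduct_sub, dotProduct_smul, sub_dotProduct, smul_dotProduct,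
                smul_eq_mul] at this ⊢
          linarith)
      refine ⟨Fin.cons (s * (b ⬝ᵥ x0) - ∑ i, u i * (s * (a i.succ ⬝ᵥ x0))) u, ?_, ?_⟩
      · intro i
        refine Fin.cases ?_ ?_ i
        · simp only [Fin.cons_zero]
          have : ∑ i, u i * (s * (a i.succ ⬝ᵥ x0)) ≤ 0 :=
            Finset.sum_nonpos fun i _ => mul_nonpos_of_nonneg_of_nonpos (hu i)
              (mul_nonpos_of_nonneg_of_nonpos hspos.le (hx0 i))
          have := mul_pos hspos hbx0
          linarith
        · intro j; simpa using hu j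
      · rw [Fin.sum_univ_succ]
        simp only [Fin.cons_zero, Fin.cons_succ]
        simp only [smul_sub, Finset.sum_sub_distrib, smul_smul, ← Finset.sum_smul] at hb
        rw [sub_smul]
        rw [sub_eq_iff_eq_add] at hb
        refine hb.trans ?_; abel

lemma coneOf_dot_le {n m : ℕ} {a : Fin m → Fin n → ℝ} {b : Fin n → ℝ} (hb : b ∈ coneOf a)
    {x : Fin n → ℝ} (hx : ∀ i, a i ⬝ᵥ x ≤ 0) : b ⬝ᵥ x ≤ 0 := by
  obtain ⟨u, hu, rfl⟩ := hb
  rw [sum_dotProduct]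
  refine Finset.sum_nonpos fun i _ => ?_
  rw [smul_dotProduct]
  exact mul_nonpos_of_nonneg_of_nonpos (hu i) (hx i)

lemma coneOf_closed {n m : ℕ} (a : Fin m → Fin n → ℝ) : IsClosed (coneOf a) := by
  have : coneOf a = ⋂ x ∈ {x : Fin n → ℝ | ∀ i, a i ⬝ᵥ x ≤ 0}, {b | b ⬝ᵥ x ≤ 0} := by
    ext b
    simp only [Set.mem_iInter, Set.mem_ofPred_eq]
    exact ⟨fun hb x hx => coneOf_dot_le hb hx, fun h => farkas_aux m a b h⟩
  rw [this]
  refine isClosed_biInter fun x _ => ?_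
  exact isClosed_le (by unfold dotProduct; fun_prop) continuous_const

lemma coneOf_gen {n m : ℕ} (a : Fin m → Fin n → ℝ) (i : Fin m) : a i ∈ coneOf a :=
  farkas_aux m a _ fun _ hx => hx i

lemma coneOf_add {n m : ℕ} {a : Fin m → Fin n → ℝ} {x y : Fin n → ℝ} (hx : x ∈ coneOf a)
    (hy : y ∈ coneOf a) {s t : ℝ} (hs : 0 ≤ s) (ht : 0 ≤ t) : s • x + t • y ∈ coneOf a := by
  refine farkas_aux m a _ fun c hc => ?_
  rw [add_dotProduct, smul_dotProduct, smul_dotProduct]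
  have h1 := mul_nonpos_of_nonneg_of_nonpos hs (coneOf_dot_le hx hc)
  have h2 := mul_nonpos_of_nonneg_of_nonpos ht (coneOf_dot_le hy hc)
  simp only [smul_eq_mul]
  linarith

lemma max_aux {n m : ℕ} (v : Fin m → Fin n → ℝ) (w : Fin n → ℝ)
    (hv : ∀ d : Fin n → ℝ, (∀ i, v i ⬝ᵥ d = 0) → d = 0) (I : Set (Fin m)) :
    ∀ (k : ℕ) (c : Fin n → ℝ), (Finset.univ.filter fun i => v i ⬝ᵥ c ≠ 0).card = k →
      (∀ i, v i ⬝ᵥ c ≤ 0) → (∀ i ∈ I, v i ⬝ᵥ c = 0) → w ⬝ᵥ c = 1 →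
      ∃ c : Fin n → ℝ, (∀ i, v i ⬝ᵥ c ≤ 0) ∧ (∀ i ∈ I, v i ⬝ᵥ c = 0) ∧ w ⬝ᵥ c = 1 ∧
        ∀ d : Fin n → ℝ, (∀ i, v i ⬝ᵥ c = 0 → v i ⬝ᵥ d = 0) → w ⬝ᵥ d = 0 → d = 0 := by
  intro k
  induction k using Nat.strong_induction_on with
  | _ k ih =>
  intro c hk hc hI hw
  by_cases hgood : ∀ d : Fin n → ℝ, (∀ i, v i ⬝ᵥ c = 0 → v i ⬝ᵥ d = 0) → w ⬝ᵥ d = 0 → d = 0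
  · exact ⟨c, hc, hI, hw, hgood⟩
  push Not at hgood
  obtain ⟨d', hd', hwd', hne'⟩ := hgood
  have : ∃ d : Fin n → ℝ, (∀ i, v i ⬝ᵥ c = 0 → v i ⬝ᵥ d = 0) ∧ w ⬝ᵥ d = 0 ∧
      ∃ i, 0 < v i ⬝ᵥ d := by
    have : ∃ i, v i ⬝ᵥ d' ≠ 0 := by
      by_contra hcon
      push Not at hcon
      exact hne' (hv d' hcon)
    obtain ⟨i, hi⟩ := this
    rcases lt_or_gt_of_ne hi with h | h
    · refine ⟨-d', fun j hj => by simp [hd' j hj], by simp [hwd'], i, by simpa using h⟩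
    · exact ⟨d', hd', hwd', i, h⟩
  obtain ⟨d, hd, hwd, i0, hi0⟩ := this
  obtain ⟨j, hj, hmin⟩ := Finset.exists_min_image (Finset.univ.filter fun i => 0 < v i ⬝ᵥ d)
    (fun i => -(v i ⬝ᵥ c) / (v i ⬝ᵥ d)) ⟨i0, by simpa using hi0⟩
  simp only [Finset.mem_filter, Finset.mem_univ, true_and] at hj hmin
  set t := -(v j ⬝ᵥ c) / (v j ⬝ᵥ d) with ht
  have ht0 : 0 ≤ t := div_nonneg (by linarith [hc j]) hj.le
  have hdot : ∀ u : Fin n → ℝ, u ⬝ᵥ (c + t • d) = u ⬝ᵥ c + t * (u ⬝ᵥ d) := fun u => by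
    rw [dotProduct_add, dotProduct_smul, smul_eq_mul]
  refine ih _ ?_ (c + t • d) rfl ?_ ?_ ?_
  · rw [← hk]
    apply Finset.card_lt_card
    rw [Finset.ssubset_iff_of_subset]
    · refine ⟨j, ?_, ?_⟩
      · simp only [Finset.mem_filter, Finset.mem_univ, true_and]
        intro h0
        exact hj.ne' (hd j h0)
      · simp only [Finset.mem_filter, Finset.mem_univ, true_and, not_not]
        rw [hdot, ht, div_mul_cancel₀ _ hj.ne']; ring
    · intro i
      simp only [Finset.mem_filter, Finset.mem_univ, true_and]
      intro h h0
      apply h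
      rw [hdot, h0, hd i h0]; ring
  · intro i
    rw [hdot]
    by_cases hi : 0 < v i ⬝ᵥ d
    · have := hmin i hi
      rw [le_div_iff₀ hi] at this
      linarith
    · have := mul_nonpos_of_nonneg_of_nonpos ht0 (not_lt.mp hi)
      linarith [hc i]
  · intro i hi
    rw [hdot, hI i hi, hd i (hI i hi)]; ring
  · rw [hdot, hw, hwd]; ring

lemma cast_dot {n : ℕ} (a b : Fin n → ℤ) :
    (fun t => (a t : ℝ)) ⬝ᵥ (fun t => (b t : ℝ)) = ((∑ t, b t * a t : ℤ) : ℝ) := by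
  simp [dotProduct, mul_comm]

/-- A real kernel vector of an integer system gives an integer one. -/
lemma int_kernel {n m : ℕ} (v : Fin m → Fin n → ℤ) (c : Fin n → ℝ) (hc : c ≠ 0)
    (h : ∀ i, (fun t => (v i t : ℝ)) ⬝ᵥ c = 0) :
    ∃ d : Fin n → ℤ, d ≠ 0 ∧ ∀ i, v i ⬝ᵥ d = 0 := by
  let A : Matrix (Fin m) (Fin n) ℤ := Matrix.of v
  have hdet : (Aᵀ * A).det = 0 := by
    have : ((Aᵀ * A).map (Int.castRingHom ℝ)).det = 0 := by
      rw [← Matrix.exists_mulVec_eq_zero_iff]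
      refine ⟨c, hc, ?_⟩
      rw [Matrix.map_mul, ← Matrix.mulVec_mulVec]
      have : (A.map (Int.castRingHom ℝ)) *ᵥ c = 0 := by
        ext i; exact h i
      rw [this, Matrix.mulVec_zero]
    rw [← RingHom.mapMatrix_apply, ← RingHom.map_det] at this
    simpa using this
  obtain ⟨d, hd, hAd⟩ := Matrix.exists_mulVec_eq_zero_iff.mpr hdet
  refine ⟨d, hd, fun i => ?_⟩
  have h2 : A *ᵥ d ⬝ᵥ A *ᵥ d = 0 := by
    rw [Matrix.dotProduct_mulVec, ← Matrix.mulVec_transpose, Matrix.mulVec_mulVec, hAd,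
      zero_dotProduct]
  exact congrFun (dotProduct_self_eq_zero.mp h2) i

lemma primitive_part {n : ℕ} (d : Fin n → ℤ) (hd : d ≠ 0) :
    ∃ (g : ℤ) (e : Fin n → ℤ), 0 < g ∧ IsPrimitive e ∧ ∀ t, d t = g * e t := by
  obtain ⟨t0, ht0⟩ := Function.ne_iff.mp hd
  obtain ⟨e, he, hg⟩ := Finset.extract_gcd (s := (Finset.univ : Finset (Fin n)))
    (fun t => (d t).natAbs) ⟨t0, Finset.mem_univ _⟩
  set G := Finset.univ.gcd (fun t => (d t).natAbs) with hG
  have hGpos : 0 < G := by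
    rcases Nat.eq_zero_or_pos G with h | h
    · have := he t0 (Finset.mem_univ _)
      rw [h, zero_mul] at this
      exact absurd (Int.natAbs_eq_zero.mp this) ht0
    · exact h
  have hdvd : ∀ t, (G : ℤ) ∣ d t := fun t =>
    Int.natCast_dvd.mpr (Finset.gcd_dvd (Finset.mem_univ t))
  choose f hf using hdvd
  refine ⟨G, f, by exact_mod_cast hGpos, ?_, hf⟩
  unfold IsPrimitive
  rw [← hg]
  congr 1
  ext t
  have h1 := he t (Finset.mem_univ _)
  rw [hf t, Int.natAbs_mul, Int.natAbs_natCast] at h1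
  exact Nat.eq_of_mul_eq_mul_left hGpos h1

/-- The key step: a facet normal which is tight at `z` and positive on `w`. -/
lemma key {n m : ℕ} (v : Fin m → (Fin n → ℤ)) (w : Fin n → ℤ)
    (hfull : Submodule.span ℝ (coneOf (fun i t => ((v i t : ℤ) : ℝ))) = ⊤)
    (z : Fin n → ℝ) (hz : z ∈ coneOf (fun i t => ((v i t : ℤ) : ℝ))) (ε₀ : ℝ) (hε₀ : 0 < ε₀)
    (hout : ∀ ε, 0 < ε → ε ≤ ε₀ →
      z + ε • (fun t => (w t : ℝ)) ∉ coneOf (fun i t => ((v i t : ℤ) : ℝ))) :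
    ∃ e : Fin n → ℤ, IsFacetNormal (coneOf (fun i t => ((v i t : ℤ) : ℝ))) e ∧
      0 < ∑ t, e t * w t ∧ ∑ t, (e t : ℝ) * z t = 0 := by
  set a : Fin m → Fin n → ℝ := fun i t => ((v i t : ℤ) : ℝ) with ha
  set W : Fin n → ℝ := fun t => (w t : ℝ) with hW
  have hspan : ∀ d : Fin n → ℝ, (∀ i, a i ⬝ᵥ d = 0) → d = 0 := by
    intro d hd
    have hle : Submodule.span ℝ (coneOf a) ≤ LinearMap.ker (dotProductBilin ℝ ℝ d) := by
      rw [Submodule.span_le]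
      rintro x ⟨u, hu, rfl⟩
      simp only [SetLike.mem_coe, LinearMap.mem_ker, dotProductBilin_apply_apply]
      rw [dotProduct_sum]
      refine Finset.sum_eq_zero fun i _ => ?_
      rw [dotProduct_smul, dotProduct_comm, hd i, smul_zero]
    rw [hfull] at hle
    have : d ∈ LinearMap.ker (dotProductBilin ℝ ℝ d) := hle trivial
    simpa using this
  -- separate `w` from the tangent cone at `z`
  have hT : W ∉ coneOf (Fin.cons (-z) a : Fin (m + 1) → Fin n → ℝ) := by
    rintro ⟨u, hu, hWu⟩
    rw [Fin.sum_univ_succ] at hWu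
    simp only [Fin.cons_zero, Fin.cons_succ] at hWu
    have hp : (∑ i : Fin m, u i.succ • a i) ∈ coneOf a := ⟨fun i => u i.succ, fun i => hu _, rfl⟩
    set p := ∑ i : Fin m, u i.succ • a i with hpdef
    have hs1 : 0 < u 0 + 1 := by linarith [hu 0]
    set ε := min ε₀ (u 0 + 1)⁻¹ with hε
    have hεpos : 0 < ε := lt_min hε₀ (inv_pos.mpr hs1)
    refine hout ε hεpos (min_le_left _ _) ?_
    have h1 : ε * (u 0 + 1) ≤ 1 := by
      have := mul_le_mul_of_nonneg_right (min_le_right ε₀ (u 0 + 1)⁻¹) hs1.le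
      rwa [inv_mul_cancel₀ hs1.ne'] at this
    have h2 : z + ε • W = (1 - ε * u 0) • z + ε • p := by
      rw [hWu]
      ext t
      simp only [Pi.add_apply, Pi.smul_apply, Pi.neg_apply, smul_eq_mul]
      ring
    rw [h2]
    exact coneOf_add hz hp (by nlinarith) hεpos.le
  have hsep : ∃ x : Fin n → ℝ, (∀ i, (Fin.cons (-z) a : Fin (m + 1) → Fin n → ℝ) i ⬝ᵥ x ≤ 0) ∧
      0 < W ⬝ᵥ x := by
    by_contra hcon
    push Not at hcon
    exact hT (farkas_aux _ _ _ hcon)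
  obtain ⟨x, hx, hWx⟩ := hsep
  have hxz : 0 ≤ z ⬝ᵥ x := by
    have := hx 0
    simpa using this
  have hxa : ∀ i, a i ⬝ᵥ x ≤ 0 := fun i => by simpa using hx i.succ
  obtain ⟨lam, hlam, hzl⟩ := id hz
  have hxI : ∀ i ∈ {i | lam i ≠ 0}, a i ⬝ᵥ x = 0 := by
    intro i hi
    have hsum : ∑ i, lam i * (a i ⬝ᵥ x) = 0 := by
      have h1 : z ⬝ᵥ x = ∑ i, lam i * (a i ⬝ᵥ x) := by
        rw [hzl, sum_dotProduct]; simp [smul_dotProduct]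
      exact h1 ▸ le_antisymm (coneOf_dot_le hz hxa) hxz
    have := (Finset.sum_eq_zero_iff_of_nonpos (fun i _ =>
      mul_nonpos_of_nonneg_of_nonpos (hlam i) (hxa i))).mp hsum i (Finset.mem_univ _)
    exact (mul_eq_zero.mp this).resolve_left hi
  obtain ⟨c, hc, hcI, hcW, hmax⟩ := max_aux a W hspan {i | lam i ≠ 0} _ ((W ⬝ᵥ x)⁻¹ • x) rfl
    (fun i => by
      rw [dotProduct_smul]
      exact mul_nonpos_of_nonneg_of_nonpos (inv_pos.mpr hWx).le (hxa i))
    (fun i hi => by rw [dotProduct_smul, hxI i hi, smul_zero])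
    (by rw [dotProduct_smul, smul_eq_mul, inv_mul_cancel₀ hWx.ne'])
  have hc0 : c ≠ 0 := by
    rintro rfl
    simp at hcW
  classical
  -- pass to an integral vector
  obtain ⟨d, hd0, hd⟩ := int_kernel (fun i => if a i ⬝ᵥ c = 0 then v i else 0) c hc0 (by
    intro i
    by_cases h : a i ⬝ᵥ c = 0
    · simp only [h, if_true]; exact h
    · simp only [h, if_false]; simp [dotProduct])
  set D : Fin n → ℝ := fun t => (d t : ℝ) with hD
  have hdD : ∀ i, a i ⬝ᵥ c = 0 → a i ⬝ᵥ D = 0 := by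
    intro i hi
    have := hd i
    simp only [hi, if_true] at this
    rw [ha, hD, cast_dot]
    rw [dotProduct_comm] at this
    exact_mod_cast this
  have hDc : D = (W ⬝ᵥ D) • c := by
    rw [← sub_eq_zero]
    apply hmax
    · intro i hi
      rw [dotProduct_sub, dotProduct_smul, hi, hdD i hi]; simp
    · rw [dotProduct_sub, dotProduct_smul, hcW]; simp
  have hWD : W ⬝ᵥ D ≠ 0 := by
    intro h
    rw [h, zero_smul] at hDc
    apply hd0
    ext t
    have := congrFun hDc t
    simpa [hD] using this
  have hpos : ∃ d : Fin n → ℤ, ∃ r : ℝ, 0 < r ∧ ∀ t, (d t : ℝ) = r * c t := by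
    rcases lt_or_gt_of_ne hWD with h | h
    · refine ⟨-d, -(W ⬝ᵥ D), by linarith, fun t => ?_⟩
      have := congrFun hDc t
      simp only [hD, Pi.smul_apply, smul_eq_mul] at this
      simp only [Pi.neg_apply, Int.cast_neg, hD]
      linarith
    · refine ⟨d, W ⬝ᵥ D, h, fun t => ?_⟩
      simpa [hD] using congrFun hDc t
  obtain ⟨d', r, hr, hd'⟩ := hpos
  have hd'0 : d' ≠ 0 := by
    rintro rfl
    apply hc0
    ext t
    have := hd' t
    simp only [Pi.zero_apply, Int.cast_zero] at this
    exact (mul_eq_zero.mp this.symm).resolve_left hr.ne'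
  obtain ⟨g, e, hg, hprim, hge⟩ := primitive_part d' hd'0
  have hgR : (0 : ℝ) < g := by exact_mod_cast hg
  have he : ∃ ρ : ℝ, 0 < ρ ∧ ∀ t, (e t : ℝ) = ρ * c t := by
    refine ⟨r / g, div_pos hr hgR, fun t => ?_⟩
    have h1 := hd' t
    rw [hge t] at h1
    push_cast at h1
    field_simp
    linarith
  obtain ⟨ρ, hρ, heρ⟩ := he
  have hedot : ∀ y : Fin n → ℝ, ∑ t, (e t : ℝ) * y t = ρ * (y ⬝ᵥ c) := by
    intro y
    simp only [dotProduct, Finset.mul_sum, heρ]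
    exact Finset.sum_congr rfl fun t _ => by ring
  have hzc : z ⬝ᵥ c = 0 := by
    rw [hzl, sum_dotProduct]
    refine Finset.sum_eq_zero fun i _ => ?_
    rw [smul_dotProduct]
    by_cases hi : lam i = 0
    · rw [hi, zero_smul]
    · rw [hcI i hi, smul_zero]
  refine ⟨e, ⟨hprim, ?_, ?_⟩, ?_, ?_⟩
  · intro y hy
    rw [hedot]
    exact mul_nonpos_of_nonneg_of_nonpos hρ.le (coneOf_dot_le hy hc)
  · set S : Set (Fin n → ℝ) := {x | x ∈ coneOf a ∧ ∑ t, (e t : ℝ) * x t = 0} with hS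
    have hker : Submodule.span ℝ S ≤ LinearMap.ker (dotProductBilin ℝ ℝ c) := by
      rw [Submodule.span_le]
      rintro y ⟨_, hy⟩
      rw [hedot] at hy
      simp only [SetLike.mem_coe, LinearMap.mem_ker, dotProductBilin_apply_apply]
      rw [dotProduct_comm]
      exact (mul_eq_zero.mp hy).resolve_left hρ.ne'
    have hlt : Module.finrank ℝ (Submodule.span ℝ S) < n := by
      have : Submodule.span ℝ S < ⊤ := by
        rw [lt_top_iff_ne_top]
        intro htop
        rw [htop] at hker
        have : c ∈ LinearMap.ker (dotProductBilin ℝ ℝ c) := hker trivial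
        apply hc0
        simpa using this
      simpa using Submodule.finrank_lt this.ne
    have htop : Submodule.span ℝ S ⊔ Submodule.span ℝ {W} = ⊤ := by
      by_contra hne
      obtain ⟨f, hf0, hf⟩ := Submodule.exists_le_ker_of_lt_top _ (lt_top_iff_ne_top.mpr hne)
      have hfd : ∀ y, f y = y ⬝ᵥ (fun t => f (Pi.single t 1)) := by
        intro y
        conv_lhs => rw [pi_eq_sum_univ' y]
        simp [dotProduct, Pi.single_apply, map_sum]
      have hzero : (fun t => f (Pi.single t 1)) = 0 := by
        apply hmax
        · intro i hi
          rw [← hfd]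
          have : a i ∈ Submodule.span ℝ S := Submodule.subset_span
            ⟨coneOf_gen a i, by rw [hedot, hi, mul_zero]⟩
          exact hf (Submodule.mem_sup_left this)
        · rw [← hfd]
          exact hf (Submodule.mem_sup_right (Submodule.mem_span_singleton_self W))
      apply hf0
      ext1 y
      ext
      simpa using congrFun hzero y
    have h1 := Submodule.finrank_add_le_finrank_add_finrank (Submodule.span ℝ S)
      (Submodule.span ℝ {W})
    rw [htop, finrank_top] at h1
    have h2 : Module.finrank ℝ (Submodule.span ℝ {W}) ≤ 1 := by
      simpa using finrank_span_le_card (R := ℝ) ({W} : Set (Fin n → ℝ))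
    simp only [Module.finrank_fin_fun] at h1
    omega
  · have h := hedot W
    rw [hcW, mul_one] at h
    have : ((∑ t, e t * w t : ℤ) : ℝ) = ρ := by
      rw [← h]; push_cast; rfl
    have h3 : (0 : ℝ) < ((∑ t, e t * w t : ℤ) : ℝ) := this ▸ hρ
    exact_mod_cast h3
  · rw [hedot, hzc, mul_zero]

end Helpers

/-- Adjoining the ray through `v` to a full-dimensional cone `C'` subdivides the
new cone into `C'` together with the cones over the facets visible from `v`. -/
theorem stmt11 {n m q : ℕ} (v : Fin m → (Fin n → ℤ)) (w : Fin n → ℤ)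
    (C' : Set (Fin n → ℝ))
    (hC' : C' = coneOf (fun i t => ((v i t : ℤ) : ℝ)))
    (hfull : Submodule.span ℝ C' = ⊤)
    (hwnot : (fun t => ((w t : ℤ) : ℝ)) ∉ C')
    (cf : Fin q → (Fin n → ℤ))
    (F : Fin q → Set (Fin n → ℝ))
    (hF : ∀ i, F i = {x | x ∈ C' ∧ ∑ t, (cf i t : ℝ) * x t = 0})
    (hfacets : ∀ i, IsFacetNormal C' (cf i))
    (hvisible : ∀ i, 0 < ∑ t, cf i t * w t)
    (hall : ∀ c : Fin n → ℤ, IsFacetNormal C' c → 0 < ∑ t, c t * w t → ∃ i, c = cf i) :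
    addRay C' (fun t => ((w t : ℤ) : ℝ)) =
      C' ∪ ⋃ i, addRay (F i) (fun t => ((w t : ℤ) : ℝ)) := by
  subst hC'
  set W : Fin n → ℝ := fun t => ((w t : ℤ) : ℝ) with hW
  apply Set.Subset.antisymm
  · rintro y ⟨x, hx, μ, hμ, hy⟩
    by_cases hyC : y ∈ coneOf (fun i t => ((v i t : ℤ) : ℝ))
    · exact Or.inl hyC
    right
    have hcomp : IsCompact (Set.Icc 0 μ ∩
        (fun l : ℝ => y - l • W) ⁻¹' coneOf (fun i t => ((v i t : ℤ) : ℝ))) :=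
      isCompact_Icc.inter_right ((coneOf_closed _).preimage (by fun_prop))
    obtain ⟨l, ⟨⟨hl0, hlμ⟩, hl⟩, hmin⟩ := hcomp.exists_isLeast
      ⟨μ, ⟨hμ, le_rfl⟩, by simpa [hy] using hx⟩
    have hlpos : 0 < l := by
      rcases hl0.eq_or_lt with h | h
      · exact absurd (by simpa [← h] using hl) hyC
      · exact h
    obtain ⟨e, he, hew, hez⟩ := key v w hfull (y - l • W) hl l hlpos (by
      intro ε hε hεl hmem
      have heq : y - l • W + ε • (fun t => ((w t : ℤ) : ℝ)) = y - (l - ε) • W := by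
        rw [sub_smul]; abel
      rw [heq] at hmem
      have := hmin ⟨⟨by linarith, by linarith⟩, hmem⟩
      linarith)
    obtain ⟨i, rfl⟩ := hall e he hew
    refine Set.mem_iUnion.mpr ⟨i, y - l • W, ?_, l, hl0, by simp⟩
    rw [hF i]
    exact ⟨hl, hez⟩
  · rintro y (hy | hy)
    · exact ⟨y, hy, 0, le_rfl, by simp⟩
    · obtain ⟨i, x, hx, μ, hμ, hxy⟩ := Set.mem_iUnion.mp hy
      rw [hF i] at hx
      exact ⟨x, hx.1, μ, hμ, hxy⟩
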